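/- Let G = U(C_l; T_1, T_2, …, T_l) be a finite connected unicyclic graph such that some T_i with 1 ≤ i ≤ l−1 is not a path having v_i as an end-vertex. Let G' = U(C_l; P_1, P_2, …, P_{l−1}, T_l) be the unicyclic graph obtained from G by replacing each tree T_i (1 ≤ i ≤ l−1) by a path P_i on |V(T_i)| vertices attached at its end-vertex v_i, keeping T_l unchanged. Then Kf(G) < Kf(G'). -/

import Mathlib

open scoped Classical

noncomputable section

namespace KfPaper

variable {V : Type*} {W : Type*}

/-- The energy of a potential `f` on graph `G`, viewing each edge as a unit resistor:
`(1/2) · ∑_{x,y adjacent} (f x - f y)²` (each edge counted twice, hence the `1/2`). -/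
def energy [Fintype V] (G : SimpleGraph V) (f : V → ℝ) : ℝ :=
  (1 / 2) * ∑ x : V, ∑ y : V, (if G.Adj x y then (f x - f y) ^ 2 else 0)

/-- The resistance distance (effective resistance) between `u` and `v`:
`r(u,v) = 1 / inf { energy f : f u = 1, f v = 0 }` and `r(u,u) = 0`. -/
def resistanceDistance [Fintype V] (G : SimpleGraph V) (u v : V) : ℝ :=
  if u = v then 0
  else 1 / sInf {e : ℝ | ∃ f : V → ℝ, f u = 1 ∧ f v = 0 ∧ energy G f = e}

/-- The Kirchhoff index: sum of resistance distances over unordered pairs of distinct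
vertices (each ordered pair counted once via the factor `1/2`, diagonal terms vanish). -/
def kirchhoffIndex [Fintype V] (G : SimpleGraph V) : ℝ :=
  (1 / 2) * ∑ u : V, ∑ v : V, resistanceDistance G u v

/-- `Kf_v(G) = ∑_{u ≠ v} r(v,u)` (the term `u = v` contributes `0`). -/
def kirchhoffAt [Fintype V] (G : SimpleGraph V) (v : V) : ℝ :=
  ∑ u : V, resistanceDistance G v u

/-- The Wiener index: sum of graph distances over unordered pairs of distinct vertices. -/
def wienerIndex [Fintype V] (G : SimpleGraph V) : ℝ :=
  (1 / 2) * ∑ u : V, ∑ v : V, (G.dist u v : ℝ)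

/-- `W_v(G) = ∑_u d(v,u)`. -/
def wienerAt [Fintype V] (G : SimpleGraph V) (v : V) : ℝ :=
  ∑ u : V, (G.dist v u : ℝ)

/-- The degree of a vertex. -/
def degree' (G : SimpleGraph V) (v : V) : ℕ := Nat.card (G.neighborSet v)

/-- `G` has maximum degree `Δ`. -/
def HasMaxDegree (G : SimpleGraph V) (Δ : ℕ) : Prop :=
  (∀ v, degree' G v ≤ Δ) ∧ ∃ v, degree' G v = Δ

/-- A unicyclic graph: a connected graph containing exactly one cycle, equivalently a
connected graph with as many edges as vertices. -/
def IsUnicyclic [Fintype V] (G : SimpleGraph V) : Prop :=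
  G.Connected ∧ Nat.card G.edgeSet = Fintype.card V

/-- The branch (tree) of `G` at `x` relative to a set `S` of vertices: the set of vertices
reachable from `x` by walks avoiding `S \ {x}`, i.e. the vertex set of the component of
`G − (S ∖ {x})` containing `x`. -/
def branch (G : SimpleGraph V) (S : Set V) (x : V) : Set V :=
  {u | ∃ p : G.Walk x u, ∀ y ∈ p.support, y ∉ S \ {x}}

/-- `H` is a path graph having `r` as one of its end-vertices. -/
def IsEndPath (H : SimpleGraph W) (r : W) : Prop :=
  ∃ (m : ℕ) (e : H ≃g SimpleGraph.pathGraph m), (e r).val = 0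

section Distances

lemma iso_edist_le {W W' : Type*} {H : SimpleGraph W} {H' : SimpleGraph W'} (e : H ≃g H')
    (x y : W) : H'.edist (e x) (e y) ≤ H.edist x y := by
  refine le_iInf fun p => ?_
  have := SimpleGraph.edist_le (p.map e.toHom)
  rwa [SimpleGraph.Walk.length_map] at this

lemma iso_dist_eq {W W' : Type*} {H : SimpleGraph W} {H' : SimpleGraph W'} (e : H ≃g H')
    (x y : W) : H'.dist (e x) (e y) = H.dist x y := by
  unfold SimpleGraph.dist
  congr 1
  refine le_antisymm (iso_edist_le e x y) ?_
  simpa using iso_edist_le e.symm (e x) (e y)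

/-- A function to `ℕ` whose set of values is an initial segment has sum at most
`0 + 1 + ⋯ + (n - 1)`, with equality only if it is injective. -/
lemma two_mul_sum_le_of_initial {α : Type*} (s : Finset α) (f : α → ℕ)
    (hf : ∀ y ∈ s, ∀ k, f y = k + 1 → ∃ z ∈ s, f z = k) :
    2 * ∑ y ∈ s, f y ≤ s.card * (s.card - 1) ∧
      (2 * ∑ y ∈ s, f y = s.card * (s.card - 1) → Set.InjOn f s) := by
  induction hn : s.card generalizing s with
  | zero => rw [Finset.card_eq_zero] at hn; subst hn; simp
  | succ n ih =>
    have hne : s.Nonempty := by rw [← Finset.card_pos]; omega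
    obtain ⟨a, ha, hmax⟩ := s.exists_max_image f hne
    have hsub : ∀ k, k ≤ f a → ∃ z ∈ s, f z = k := by
      intro k hk
      induction hd : f a - k generalizing k with
      | zero => exact ⟨a, ha, by omega⟩
      | succ d ihd =>
        obtain ⟨z, hz, hzk⟩ := ihd (k + 1) (by omega) (by omega)
        exact hf z hz k hzk
    have himg : Finset.range (f a + 1) ⊆ s.image f := by
      intro k hk
      obtain ⟨z, hz, rfl⟩ := hsub k (by simpa [Nat.lt_succ_iff] using hk)
      exact Finset.mem_image_of_mem f hz
    have hle : f a + 1 ≤ (s.image f).card := by simpa using Finset.card_le_card himg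
    have hcard := Finset.card_image_le (s := s) (f := f)
    have herase := Finset.card_erase_of_mem ha
    obtain ⟨h1, -⟩ := ih (s.erase a) (by
      intro y hy k hk
      rw [Finset.mem_erase] at hy
      obtain ⟨z, hz, hzk⟩ := hf y hy.2 k hk
      refine ⟨z, Finset.mem_erase.2 ⟨?_, hz⟩, hzk⟩
      rintro rfl
      have := hmax y hy.2
      omega) (by omega)
    rw [← Finset.add_sum_erase s f ha]
    have hid : n * (n - 1) + 2 * n = (n + 1) * n := by
      cases n with
      | zero => rfl
      | succ m => simp only [Nat.add_sub_cancel]; ring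
    simp only [Nat.add_sub_cancel]
    refine ⟨by omega, fun heq => ?_⟩
    exact Finset.card_image_iff.1 (by omega)

variable {H : SimpleGraph W}

lemma exists_adj_dist_eq (hH : H.Connected) {r y : W} {k : ℕ} (h : H.dist r y = k + 1) :
    ∃ z, H.Adj z y ∧ H.dist r z = k := by
  obtain ⟨p, hp⟩ := hH.exists_walk_length_eq_dist y r
  rw [SimpleGraph.dist_comm, h] at hp
  cases p with
  | nil => simp at hp
  | @cons _ z _ hyz q =>
    refine ⟨z, hyz.symm, ?_⟩
    have h1 : H.dist r z ≤ q.length := SimpleGraph.dist_comm (G := H) ▸ SimpleGraph.dist_le q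
    have h2 := hH.dist_triangle (u := r) (v := z) (w := y)
    rw [SimpleGraph.dist_eq_one_iff_adj.2 hyz.symm] at h2
    simp only [SimpleGraph.Walk.length_cons] at hp
    omega

variable [Fintype W]

lemma two_mul_sum_dist_le (hH : H.Connected) (r : W) :
    2 * ∑ y, H.dist r y ≤ Fintype.card W * (Fintype.card W - 1) :=
  (two_mul_sum_le_of_initial Finset.univ (H.dist r) fun _ _ _ hk =>
    let ⟨z, _, hz⟩ := exists_adj_dist_eq hH hk
    ⟨z, Finset.mem_univ z, hz⟩).1

lemma isEndPath_of_two_mul_sum_dist_eq (hH : H.Connected) (r : W)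
    (heq : 2 * ∑ y, H.dist r y = Fintype.card W * (Fintype.card W - 1)) : IsEndPath H r := by
  have hex : ∀ y k, H.dist r y = k + 1 → ∃ z, H.Adj z y ∧ H.dist r z = k :=
    fun y k => exists_adj_dist_eq hH
  have hinj : Function.Injective (H.dist r) := by
    have := (two_mul_sum_le_of_initial Finset.univ (H.dist r) fun y _ k hk =>
      let ⟨z, _, hz⟩ := hex y k hk
      ⟨z, Finset.mem_univ z, hz⟩).2 (by simpa using heq)
    simpa [Set.injOn_univ] using this
  have hlt : ∀ y, H.dist r y < Fintype.card W := by
    intro y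
    have hsub : ∀ k, ∀ y, H.dist r y = k → ∀ j ≤ k, ∃ z, H.dist r z = j := by
      intro k
      induction k with
      | zero => intro y hy j hj; exact ⟨y, by omega⟩
      | succ k ih =>
        intro y hy j hj
        obtain rfl | hj := Nat.eq_or_lt_of_le hj
        · exact ⟨y, hy⟩
        · obtain ⟨z, -, hz⟩ := hex y k hy
          exact ih z hz j (by omega)
    have himg : Finset.range (H.dist r y + 1) ⊆ Finset.univ.image (H.dist r) := by
      intro j hj
      obtain ⟨z, hz⟩ := hsub _ y rfl j (by simpa [Nat.lt_succ_iff] using hj)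
      exact Finset.mem_image.2 ⟨z, Finset.mem_univ z, hz⟩
    have h1 := Finset.card_le_card himg
    have h2 := Finset.card_image_le (s := Finset.univ) (f := H.dist r)
    rw [Finset.card_range] at h1
    rw [Finset.card_univ] at h2
    omega
  have hbij : Function.Bijective (fun y => (⟨H.dist r y, hlt y⟩ : Fin (Fintype.card W))) := by
    rw [Fintype.bijective_iff_injective_and_card]
    exact ⟨fun a b hab => hinj (Fin.mk.inj_iff.1 hab), by simp⟩
  refine ⟨Fintype.card W, ⟨Equiv.ofBijective _ hbij, ?_⟩, SimpleGraph.dist_self⟩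
  intro a b
  have hstep : ∀ a b, H.dist r a + 1 = H.dist r b → H.Adj a b := by
    intro a b h
    obtain ⟨z, hz, hzd⟩ := hex b _ h.symm
    rwa [hinj hzd] at hz
  simp only [SimpleGraph.pathGraph_adj, Equiv.ofBijective_apply]
  constructor
  · rintro (h | h)
    · exact hstep a b h
    · exact (hstep b a h).symm
  · intro hab
    have hd1 := SimpleGraph.dist_eq_one_iff_adj.2 hab
    have h1 := hH.dist_triangle (u := r) (v := a) (w := b)
    have h2 := hH.dist_triangle (u := r) (v := b) (w := a)
    rw [SimpleGraph.dist_comm (u := b) (v := a)] at h2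
    have h3 : H.dist r a ≠ H.dist r b := fun h => hab.ne (hinj h)
    omega

/-- Among connected graphs of given order, the sum of all distances is at most that of a path. -/
lemma three_mul_sum_sum_dist_le (hH : H.Connected) :
    3 * ∑ x, ∑ y, H.dist x y + Fintype.card W ≤ Fintype.card W ^ 3 := by
  induction hn : Fintype.card W using Nat.strong_induction_on generalizing W with
  | _ n ih =>
  have := hH.nonempty
  rcases subsingleton_or_nontrivial W with hs | hnt
  · have hz : ∀ x y, H.dist x y = 0 := fun x y => by rw [Subsingleton.elim x y]; simp
    have h1 : 0 < n := hn ▸ Fintype.card_pos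
    simp only [hz, Finset.sum_const_zero]
    nlinarith [Nat.pow_le_pow_right h1 (show 1 ≤ 3 by norm_num)]
  · obtain ⟨a, ha⟩ := hH.exists_connected_induce_compl_singleton_of_finite_nontrivial
    have hcard : Fintype.card ({a}ᶜ : Set W) = n - 1 := by
      rw [Fintype.card_compl_set]; simp [hn]
    have h1 : 0 < n := hn ▸ Fintype.card_pos
    have hI := ih (n - 1) (by omega) ha hcard
    have hsplit : ∀ f : W → ℕ, ∑ x, f x = f a + ∑ x : ({a}ᶜ : Set W), f x := by
      intro f
      rw [← Finset.add_sum_erase _ f (Finset.mem_univ a)]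
      congr 1
      exact (Finset.sum_subtype _ (by simp) f)
    have hD := two_mul_sum_dist_le hH a
    rw [hn] at hD
    have hle : ∀ x y : ({a}ᶜ : Set W), H.dist x y ≤ (H.induce {a}ᶜ).dist x y := by
      intro x y
      obtain ⟨p, hp⟩ := ha.exists_walk_length_eq_dist x y
      rw [← hp]
      have := SimpleGraph.dist_le (p.map (SimpleGraph.Embedding.induce ({a}ᶜ : Set W)).toHom)
      rwa [SimpleGraph.Walk.length_map] at this
    have hle2 : ∑ x : ({a}ᶜ : Set W), ∑ y : ({a}ᶜ : Set W), H.dist x y ≤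
        ∑ x, ∑ y, (H.induce {a}ᶜ).dist x y :=
      Finset.sum_le_sum fun x _ => Finset.sum_le_sum fun y _ => hle x y
    have htot : ∑ x, ∑ y, H.dist x y = 2 * ∑ y, H.dist a y +
        ∑ x : ({a}ᶜ : Set W), ∑ y : ({a}ᶜ : Set W), H.dist x y := by
      rw [hsplit (fun x => ∑ y, H.dist x y)]
      have : ∀ x : ({a}ᶜ : Set W), ∑ y, H.dist x y =
          H.dist a x + ∑ y : ({a}ᶜ : Set W), H.dist x y := by
        intro x; rw [hsplit, SimpleGraph.dist_comm]
      simp only [this, Finset.sum_add_distrib]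
      have h3 := hsplit (H.dist a)
      rw [SimpleGraph.dist_self, zero_add] at h3
      rw [← h3]
      ring
    rw [htot]
    obtain ⟨m, rfl⟩ : ∃ m, n = m + 1 := ⟨n - 1, by omega⟩
    simp only [Nat.add_sub_cancel] at hI hD
    nlinarith

lemma pathGraph_abs_sub_le_dist {m : ℕ} (a b : Fin m) :
    |(a.val : ℝ) - b.val| ≤ (SimpleGraph.pathGraph m).dist a b := by
  have hw : ∀ {a b : Fin m} (p : (SimpleGraph.pathGraph m).Walk a b),
      |(a.val : ℝ) - b.val| ≤ p.length := by
    intro a b p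
    induction p with
    | nil => simp
    | @cons a c b h p ih =>
      have h1 : |(a.val : ℝ) - c.val| ≤ 1 := by
        rw [SimpleGraph.pathGraph_adj] at h
        rcases h with h | h <;> rw [← h] <;> simp
      have := abs_sub_le (a.val : ℝ) c.val b.val
      simp only [SimpleGraph.Walk.length_cons, Nat.cast_add, Nat.cast_one]
      linarith
  have hc : (SimpleGraph.pathGraph m).Connected := by
    cases m with
    | zero => exact a.elim0
    | succ n => exact SimpleGraph.pathGraph_connected n
  obtain ⟨p, hp⟩ := hc.exists_walk_length_eq_dist a b
  rw [← hp]
  exact hw p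

lemma two_mul_sum_val (m : ℕ) : 2 * ∑ a : Fin m, (a.val : ℝ) = m * (m - 1) := by
  rw [Fin.sum_univ_eq_sum_range (fun i => (i : ℝ)) m]
  induction m with
  | zero => simp
  | succ n ih => rw [Finset.sum_range_succ, mul_add, ih]; push_cast; ring

lemma three_mul_sum_sum_abs_sub (m : ℕ) :
    3 * ∑ a : Fin m, ∑ b : Fin m, |(a.val : ℝ) - b.val| = m ^ 3 - m := by
  induction m with
  | zero => simp
  | succ n ih =>
    have h1 : ∀ a : Fin n, |(a.val : ℝ) - n| = n - a.val := by
      intro a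
      have : (a.val : ℝ) ≤ n := by exact_mod_cast a.2.le
      rw [abs_sub_comm, abs_of_nonneg (by linarith)]
    simp only [Fin.sum_univ_castSucc, Fin.val_castSucc, Fin.val_last, Finset.sum_add_distrib,
      sub_self, abs_zero, abs_sub_comm (n : ℝ), h1, Finset.sum_sub_distrib, Finset.sum_const,
      Finset.card_univ, Fintype.card_fin, nsmul_eq_mul]
    have := two_mul_sum_val n
    push_cast
    linarith

lemma le_two_mul_sum_dist_of_isEndPath {r : W} (h : IsEndPath H r) :
    (Fintype.card W : ℝ) * (Fintype.card W - 1) ≤ 2 * ∑ y, (H.dist r y : ℝ) := by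
  obtain ⟨m, e, he⟩ := h
  have hm : Fintype.card W = m := by simpa using Fintype.card_congr e.toEquiv
  rw [hm, ← two_mul_sum_val, ← e.toEquiv.sum_comp]
  gcongr with y
  have := pathGraph_abs_sub_le_dist (e r) (e y)
  rw [he, iso_dist_eq] at this
  simpa using this

lemma le_three_mul_sum_sum_dist_of_isEndPath {r : W} (h : IsEndPath H r) :
    (Fintype.card W : ℝ) ^ 3 - Fintype.card W ≤ 3 * ∑ x, ∑ y, (H.dist x y : ℝ) := by
  obtain ⟨m, e, -⟩ := h
  have hm : Fintype.card W = m := by simpa using Fintype.card_congr e.toEquiv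
  rw [hm, ← three_mul_sum_sum_abs_sub, ← e.toEquiv.sum_comp]
  gcongr with x
  rw [← e.toEquiv.sum_comp]
  gcongr with y
  have := pathGraph_abs_sub_le_dist (e x) (e y)
  rwa [iso_dist_eq] at this

variable {W' : Type*} [Fintype W'] {H' : SimpleGraph W'}

lemma wienerIndex_congr (e : H ≃g H') : wienerIndex H = wienerIndex H' := by
  unfold wienerIndex
  rw [← e.toEquiv.sum_comp]
  congr 1
  refine Finset.sum_congr rfl fun x _ => ?_
  rw [← e.toEquiv.sum_comp]
  exact Finset.sum_congr rfl fun y _ => by rw [← iso_dist_eq e]; rfl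

lemma wienerAt_congr (e : H ≃g H') (r : W) : wienerAt H' (e r) = wienerAt H r := by
  unfold wienerAt
  rw [← e.toEquiv.sum_comp]
  exact Finset.sum_congr rfl fun y _ => by rw [← iso_dist_eq e]; rfl

lemma wienerIndex_le_of_isEndPath (hH : H.Connected) {r' : W'} (hH' : IsEndPath H' r')
    (hcard : Fintype.card W' = Fintype.card W) : wienerIndex H ≤ wienerIndex H' := by
  have h1 := three_mul_sum_sum_dist_le hH
  have h2 := le_three_mul_sum_sum_dist_of_isEndPath hH'
  rw [hcard] at h2
  have h3 : 3 * ∑ x, ∑ y, (H.dist x y : ℝ) + Fintype.card W ≤ (Fintype.card W : ℝ) ^ 3 := by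
    exact_mod_cast h1
  unfold wienerIndex
  linarith

lemma two_mul_wienerAt_le (hH : H.Connected) (r : W) :
    2 * wienerAt H r ≤ Fintype.card W * ((Fintype.card W : ℝ) - 1) := by
  have := hH.nonempty
  have h1 := two_mul_sum_dist_le hH r
  rw [← Nat.cast_pred Fintype.card_pos]
  unfold wienerAt
  exact_mod_cast h1

lemma wienerAt_le_of_isEndPath (hH : H.Connected) {r' : W'} (hH' : IsEndPath H' r')
    (hcard : Fintype.card W' = Fintype.card W) (r : W) : wienerAt H r ≤ wienerAt H' r' := by
  have h1 := two_mul_wienerAt_le hH r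
  have h2 := le_two_mul_sum_dist_of_isEndPath hH'
  rw [hcard] at h2
  unfold wienerAt at *
  linarith

lemma wienerAt_lt_of_isEndPath (hH : H.Connected) {r : W} (hr : ¬ IsEndPath H r) {r' : W'}
    (hH' : IsEndPath H' r') (hcard : Fintype.card W' = Fintype.card W) :
    wienerAt H r < wienerAt H' r' := by
  refine lt_of_le_of_ne (wienerAt_le_of_isEndPath hH hH' hcard r) fun heq => hr ?_
  have := hH.nonempty
  have h1 := two_mul_wienerAt_le hH r
  have h2 := le_two_mul_sum_dist_of_isEndPath hH'
  rw [hcard] at h2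
  refine isEndPath_of_two_mul_sum_dist_eq hH r ?_
  have h3 : 2 * wienerAt H r = Fintype.card W * ((Fintype.card W : ℝ) - 1) := by
    unfold wienerAt at *
    linarith
  rw [← Nat.cast_pred Fintype.card_pos] at h3
  unfold wienerAt at h3
  exact_mod_cast h3

end Distances

/-- The bilinear form polarizing `energy G`. -/
def energyForm [Fintype V] (G : SimpleGraph V) (g f : V → ℝ) : ℝ :=
  (1 / 2) * ∑ x : V, ∑ y : V, (if G.Adj x y then (g x - g y) * (f x - f y) else 0)

/-- `g` is a potential of the unit current flowing from `u` to `v`, in weak form. -/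
def IsUnitPotential [Fintype V] (G : SimpleGraph V) (u v : V) (g : V → ℝ) : Prop :=
  ∀ f : V → ℝ, energyForm G g f = f u - f v

section Resistance

variable [Fintype V] {G : SimpleGraph V} {u v w : V} {g : V → ℝ}

lemma energyForm_self (G : SimpleGraph V) (f : V → ℝ) : energyForm G f f = energy G f := by
  simp only [energyForm, energy, sq]

lemma energy_nonneg (G : SimpleGraph V) (f : V → ℝ) : 0 ≤ energy G f := by
  unfold energy
  have : ∀ x y, 0 ≤ (if G.Adj x y then (f x - f y) ^ 2 else 0) := by
    intro x y; split_ifs <;> positivity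
  exact mul_nonneg (by norm_num) (Finset.sum_nonneg fun x _ => Finset.sum_nonneg fun y _ => this x y)

lemma energyForm_add_left (G : SimpleGraph V) (g₁ g₂ f : V → ℝ) :
    energyForm G (g₁ + g₂) f = energyForm G g₁ f + energyForm G g₂ f := by
  simp only [energyForm, ← mul_add, ← Finset.sum_add_distrib, Pi.add_apply]
  congr 1
  refine Finset.sum_congr rfl fun x _ => Finset.sum_congr rfl fun y _ => ?_
  split_ifs <;> ring

lemma energy_sub_smul (G : SimpleGraph V) (f g : V → ℝ) (t : ℝ) :
    energy G (fun x => f x - t * g x) =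
      energy G f - 2 * t * energyForm G g f + t ^ 2 * energy G g := by
  simp only [energyForm, energy, Finset.mul_sum, ← Finset.sum_add_distrib,
    ← Finset.sum_sub_distrib]
  congr! 2
  split_ifs <;> ring

lemma energy_affine (G : SimpleGraph V) (g : V → ℝ) (c t : ℝ) :
    energy G (fun x => t * (g x - c)) = t ^ 2 * energy G g := by
  simp only [energy, Finset.mul_sum]
  congr! 2
  split_ifs <;> ring

lemma IsUnitPotential.add {g₁ g₂ : V → ℝ} (h₁ : IsUnitPotential G u w g₁)
    (h₂ : IsUnitPotential G w v g₂) : IsUnitPotential G u v (g₁ + g₂) := by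
  intro f
  rw [energyForm_add_left, h₁ f, h₂ f]
  ring

lemma IsUnitPotential.resistanceDistance_eq (h : IsUnitPotential G u v g) :
    resistanceDistance G u v = g u - g v := by
  unfold resistanceDistance
  split_ifs with huv
  · simp [huv]
  have hR : energy G g = g u - g v := by rw [← energyForm_self, h g]
  set R := g u - g v with hRdef
  have key : ∀ f : V → ℝ, f u = 1 → f v = 0 → ∀ t : ℝ, 0 ≤ energy G f - 2 * t + t ^ 2 * R := by
    intro f hu hv t
    have := energy_nonneg G (fun x => f x - t * g x)
    rw [energy_sub_smul, h f, hu, hv, hR] at this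
    linarith
  have hR0 : 0 ≤ R := hR ▸ energy_nonneg G g
  have hRpos : 0 < R := by
    refine lt_of_le_of_ne hR0 fun h0 => ?_
    have := key (fun x => if x = u then 1 else 0) (by simp) (by simp [Ne.symm huv])
      (energy G (fun x => if x = u then 1 else 0) + 1)
    rw [← h0] at this
    have := energy_nonneg G (fun x => if x = u then 1 else 0)
    linarith
  have hleast : IsLeast {e : ℝ | ∃ f : V → ℝ, f u = 1 ∧ f v = 0 ∧ energy G f = e} (1 / R) := by
    constructor
    · refine ⟨fun x => R⁻¹ * (g x - g v), ?_, by simp, ?_⟩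
      · change R⁻¹ * R = 1
        exact inv_mul_cancel₀ hRpos.ne'
      · rw [energy_affine, hR]; field_simp
    · rintro e ⟨f, hu, hv, rfl⟩
      have := key f hu hv (1 / R)
      have h2 : energy G f - 2 * (1 / R) + (1 / R) ^ 2 * R = energy G f - 1 / R := by
        field_simp; ring
      linarith
  rw [hleast.csInf_eq, one_div_one_div]

/-- A symmetric function of pairs supported on a family of undirected edges sums to twice its sum
over the family. -/
lemma sum_sum_eq_two_mul_sum {ι : Type*} [Fintype ι] (p q : ι → V) (T : V → V → ℝ)
    (hT : ∀ x y, T x y = T y x)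
    (hinj : ∀ i j, s(p i, q i) = s(p j, q j) → i = j) (hne : ∀ i, p i ≠ q i)
    (hsupp : ∀ x y, (∀ i, s(x, y) ≠ s(p i, q i)) → T x y = 0) :
    ∑ x, ∑ y, T x y = 2 * ∑ i, T (p i) (q i) := by
  rw [← Fintype.sum_prod_type']
  have := Fintype.sum_of_injective
    (Sum.elim (fun i => (p i, q i)) (fun i => (q i, p i)) : ι ⊕ ι → V × V)
    (by
      rintro (i | i) (j | j) h <;> simp only [Sum.elim_inl, Sum.elim_inr, Prod.mk.injEq] at h
      · rw [hinj i j (by rw [h.1, h.2])]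
      · have := hinj i j (by rw [h.1, h.2, Sym2.eq_swap])
        subst this
        exact absurd h.1 (hne i)
      · have := hinj i j (by rw [h.1, h.2, Sym2.eq_swap])
        subst this
        exact absurd h.2 (hne i)
      · rw [hinj i j (by rw [h.1, h.2])])
    (fun i => Sum.elim (fun i => T (p i) (q i)) (fun i => T (p i) (q i)) i)
    (fun z => T z.1 z.2)
    (by
      rintro ⟨x, y⟩ hz
      refine hsupp x y fun i hi => hz ?_
      rcases Sym2.eq_iff.1 hi with ⟨rfl, rfl⟩ | ⟨rfl, rfl⟩
      · exact ⟨Sum.inl i, rfl⟩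
      · exact ⟨Sum.inr i, rfl⟩)
    (by rintro (i | i) <;> simp [hT (q _)])
  rw [← this, Fintype.sum_sum_type]
  simp only [Sum.elim_inl, Sum.elim_inr]
  ring

lemma exists_isUnitPotential_of_isBridge {a b : V} (hab : G.Adj a b) (hbr : G.IsBridge s(a, b)) :
    ∃ χ : V → ℝ, IsUnitPotential G a b χ ∧ χ a - χ b = 1 ∧
      ∀ x y, G.Adj x y → s(x, y) ≠ s(a, b) → χ x = χ y := by
  let χ : V → ℝ := fun x => if (G.deleteEdges {s(a, b)}).Reachable a x then 1 else 0
  have ha : χ a = 1 := if_pos (SimpleGraph.Reachable.refl a)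
  have hb : χ b = 0 := if_neg (SimpleGraph.isBridge_iff.1 hbr)
  have hc : ∀ x y, G.Adj x y → s(x, y) ≠ s(a, b) → χ x = χ y := by
    intro x y hxy hne
    have hadj : (G.deleteEdges {s(a, b)}).Adj x y := by
      rw [SimpleGraph.deleteEdges_adj]; exact ⟨hxy, hne⟩
    have : (G.deleteEdges {s(a, b)}).Reachable a x ↔ (G.deleteEdges {s(a, b)}).Reachable a y :=
      ⟨fun h => h.trans hadj.reachable, fun h => h.trans hadj.symm.reachable⟩
    simp only [χ, this]
  refine ⟨χ, fun f => ?_, by rw [ha, hb]; norm_num, hc⟩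
  unfold energyForm
  rw [sum_sum_eq_two_mul_sum (ι := Unit) (fun _ => a) (fun _ => b)]
  · simp [hab, ha, hb]
  · intro x y
    simp only [G.adj_comm x y]
    split_ifs <;> ring
  · simp
  · exact fun _ => hab.ne
  · intro x y h
    split_ifs with hxy
    · rw [hc x y hxy (h ()), sub_self, zero_mul]
    · rfl

/-- A potential along a path of bridges drops by one along each edge and is constant elsewhere. -/
lemma exists_isUnitPotential_of_isPath {F : SimpleGraph V}
    (hFG : F ≤ G) (hF : ∀ x y, F.Adj x y → G.IsBridge s(x, y)) {x y : V} (p : F.Walk x y)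
    (hp : p.IsPath) :
    ∃ g : V → ℝ, IsUnitPotential G x y g ∧ g x - g y = p.length ∧
      ∀ a b, G.Adj a b → s(a, b) ∉ p.edges → g a = g b := by
  induction p with
  | nil => exact ⟨fun _ => 0, fun f => by simp [energyForm], by simp, fun _ _ _ _ => rfl⟩
  | @cons x z y h p ih =>
    rw [SimpleGraph.Walk.cons_isPath_iff] at hp
    obtain ⟨g, hg, hlen, hconst⟩ := ih hp.1
    obtain ⟨χ, hχ, hχ1, hχc⟩ := exists_isUnitPotential_of_isBridge (hFG h) (hF _ _ h)
    have hnot : s(x, z) ∉ p.edges := fun he => hp.2 (p.fst_mem_support_of_mem_edges he)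
    have hchain : ∀ {a b : V} (q : F.Walk a b), s(x, z) ∉ q.edges → χ a = χ b := by
      intro a b q hq
      induction q with
      | nil => rfl
      | cons h' q ih =>
        simp only [SimpleGraph.Walk.edges_cons, List.mem_cons, not_or] at hq
        exact (hχc _ _ (hFG h') (Ne.symm hq.1)).trans (ih hq.2)
    refine ⟨χ + g, hχ.add hg, ?_, ?_⟩
    · have h1 := hconst _ _ (hFG h) hnot
      have h2 := hchain p hnot
      simp only [Pi.add_apply, SimpleGraph.Walk.length_cons, Nat.cast_add, Nat.cast_one]
      linarith
    · intro a b hab hmem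
      simp only [SimpleGraph.Walk.edges_cons, List.mem_cons, not_or] at hmem
      simp only [Pi.add_apply, hχc a b hab hmem.1, hconst a b hab hmem.2]

end Resistance

section Cycle

variable {l : ℕ}

/-- The cyclic successor on `Fin l`. -/
def cycleSucc (i : Fin l) : Fin l := ⟨(i.val + 1) % l, Nat.mod_lt _ i.pos⟩

/-- The edges of the closed walk through the vertices `v 0, …, v (l - 1)`. -/
def cycleEdges (v : Fin l → V) : Set (Sym2 V) :=
  Set.range fun k => s(v k, v (cycleSucc k))

/-- The potential on the cycle `C_l` of the unit current flowing from `i` to `j`. -/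
def cyclePotential (l i j k : ℕ) : ℝ :=
  k * ((j : ℝ) - i) / l - (min k j : ℕ) + (min k i : ℕ)

/-- The resistance distance between the vertices `i` and `j` of the cycle `C_l`. -/
def cycleResistance (i j : Fin l) : ℝ := cyclePotential l i j i - cyclePotential l i j j

lemma cycleSucc_val (i : Fin l) :
    ((cycleSucc i).val = i.val + 1 ∧ i.val + 1 < l) ∨
      ((cycleSucc i).val = 0 ∧ i.val + 1 = l) := by
  have := i.2
  rcases Nat.lt_or_ge (i.val + 1) l with h | h
  · exact Or.inl ⟨Nat.mod_eq_of_lt h, h⟩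
  · have h : i.val + 1 = l := by omega
    exact Or.inr ⟨by simp [cycleSucc, h], h⟩

lemma cycleSucc_ne (hl : 3 ≤ l) (i : Fin l) : cycleSucc i ≠ i := by
  intro h
  have := congrArg Fin.val h
  have := cycleSucc_val i
  omega

lemma cycleEdge_injective (hl : 3 ≤ l) {v : Fin l → V} (hinj : Function.Injective v) {i j : Fin l}
    (h : s(v i, v (cycleSucc i)) = s(v j, v (cycleSucc j))) : i = j := by
  rcases Sym2.eq_iff.1 h with ⟨h1, -⟩ | ⟨h1, h2⟩
  · exact hinj h1
  · have h1 := congrArg Fin.val (hinj h1)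
    have h2 := congrArg Fin.val (hinj h2)
    have := cycleSucc_val i
    have := cycleSucc_val j
    omega

lemma eq_of_cycleSucc_eq {α : Type*} (hl : 3 ≤ l) (F : Fin l → α)
    (h : ∀ k, F k = F (cycleSucc k)) (i j : Fin l) : F i = F j := by
  have key : ∀ n (hn : n < l), F ⟨n, hn⟩ = F ⟨0, by omega⟩ := by
    intro n
    induction n with
    | zero => intro _; rfl
    | succ n ih =>
      intro hn
      rw [← ih (by omega), h ⟨n, by omega⟩]
      congr 1
      ext
      exact (Nat.mod_eq_of_lt hn).symm
  rw [key i.val i.2, key j.val j.2]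

lemma sum_ite_lt_telescope (F : ℕ → ℝ) {j l : ℕ} (hj : j ≤ l) :
    ∑ k ∈ Finset.range l, (if k < j then F k - F (k + 1) else 0) = F 0 - F j := by
  rw [← Finset.sum_filter, ← Finset.sum_range_sub']
  congr 1
  ext k
  simp only [Finset.mem_filter, Finset.mem_range]
  omega

lemma cyclePotential_sub_succ (l i j k : ℕ) :
    cyclePotential l i j k - cyclePotential l i j (k + 1) =
      -((j : ℝ) - i) / l + (if k < j then 1 else 0) - (if k < i then 1 else 0) := by
  have h : ∀ m : ℕ, ((min (k + 1) m : ℕ) : ℝ) = (min k m : ℕ) + (if k < m then 1 else 0) := by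
    intro m
    split_ifs with hm
    · rw [min_eq_left (by omega), min_eq_left (by omega)]; push_cast; ring
    · rw [min_eq_right (by omega), min_eq_right (by omega)]; ring
  unfold cyclePotential
  rw [h, h]
  push_cast
  ring

lemma sum_cyclePotential_mul (hl : 3 ≤ l) (i j : Fin l) (F : Fin l → ℝ) :
    ∑ k : Fin l, (cyclePotential l i j k - cyclePotential l i j (cycleSucc k)) *
      (F k - F (cycleSucc k)) = F i - F j := by
  let F' : ℕ → ℝ := fun n => F ⟨n % l, Nat.mod_lt _ (by omega)⟩
  have hF' : ∀ k : Fin l, F' k.val = F k := by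
    intro k
    change F _ = F _
    congr 1
    ext
    exact Nat.mod_eq_of_lt k.2
  have hl0 : (l : ℝ) ≠ 0 := by positivity
  have hφ : ∀ k : Fin l, cyclePotential l i j (cycleSucc k) =
      cyclePotential l i j (k.val + 1) := by
    intro k
    rcases cycleSucc_val k with ⟨h, -⟩ | ⟨h, h'⟩
    · rw [h]
    · rw [h, h']
      unfold cyclePotential
      rw [min_eq_right i.2.le, min_eq_right j.2.le]
      field_simp
      simp
  have hterm : ∀ k : Fin l, (cyclePotential l i j k - cyclePotential l i j (cycleSucc k)) *
      (F k - F (cycleSucc k)) = (fun k : ℕ => (-((j : ℝ) - i) / l) * (F' k - F' (k + 1)) +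
        (if k < j.val then F' k - F' (k + 1) else 0) -
        (if k < i.val then F' k - F' (k + 1) else 0)) k.val := by
    intro k
    have : F' (k.val + 1) = F (cycleSucc k) := rfl
    rw [hφ, cyclePotential_sub_succ]
    simp only [this, hF']
    split_ifs <;> ring
  rw [Finset.sum_congr rfl fun k _ => hterm k, Fin.sum_univ_eq_sum_range (n := l) (fun k : ℕ =>
      (-((j : ℝ) - i) / l) * (F' k - F' (k + 1)) + (if k < j.val then F' k - F' (k + 1) else 0) -
        (if k < i.val then F' k - F' (k + 1) else 0)), Finset.sum_sub_distrib,
    Finset.sum_add_distrib, ← Finset.mul_sum, Finset.sum_range_sub',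
    sum_ite_lt_telescope F' j.2.le, sum_ite_lt_telescope F' i.2.le, hF', hF']
  have : F' l = F' 0 := by simp [F']
  rw [this]
  ring

variable [Fintype V] {G : SimpleGraph V} {v : Fin l → V} (hl : 3 ≤ l) (huni : IsUnicyclic G)
  (hinj : Function.Injective v) (hadj : ∀ i, G.Adj (v i) (v (cycleSucc i)))

include hl huni hinj hadj in
lemma isBridge_of_notMem_cycleEdges {e : Sym2 V} (he : e ∈ G.edgeSet)
    (hc : e ∉ cycleEdges v) : G.IsBridge e := by
  by_contra hbr
  induction e with | _ a b
  have hconn := huni.1.connected_delete_edge_of_not_isBridge hbr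
  let z : Fin l := ⟨l - 1, by omega⟩
  have hz : (cycleSucc z).val = 0 := by
    have := cycleSucc_val z
    have hzv : z.val = l - 1 := rfl
    omega
  set c : Sym2 V := s(v z, v (cycleSucc z)) with hcdef
  have hreach : ∀ n (hn : n < l),
      ((G.deleteEdges {s(a, b)}).deleteEdges {c}).Reachable (v ⟨n, hn⟩) (v (cycleSucc z)) := by
    intro n
    induction n with
    | zero =>
      intro hn
      rw [show (⟨0, hn⟩ : Fin l) = cycleSucc z from Fin.ext hz.symm]
    | succ n ih =>
      intro hn
      have hs : cycleSucc ⟨n, by omega⟩ = ⟨n + 1, hn⟩ := Fin.ext (Nat.mod_eq_of_lt hn)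
      refine SimpleGraph.Reachable.trans (SimpleGraph.Adj.reachable ?_) (ih (by omega))
      rw [← hs]
      refine SimpleGraph.Adj.symm ?_
      simp only [SimpleGraph.deleteEdges_adj, Set.mem_singleton_iff]
      refine ⟨⟨hadj _, fun h => hc ⟨_, h⟩⟩, fun h => ?_⟩
      have := congrArg Fin.val (cycleEdge_injective hl hinj h)
      have hzv : z.val = l - 1 := rfl
      simp only at this
      omega
  have hnb : ¬ (G.deleteEdges {s(a, b)}).IsBridge s(v z, v (cycleSucc z)) := by
    rw [SimpleGraph.isBridge_iff, not_not]
    exact hreach _ _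
  have hcard := (hconn.connected_delete_edge_of_not_isBridge hnb).card_vert_le_card_edgeSet_add_one
  rw [SimpleGraph.edgeSet_deleteEdges, SimpleGraph.edgeSet_deleteEdges] at hcard
  have hcG : c ∈ G.edgeSet := hadj z
  have hne : c ≠ s(a, b) := fun h => hc ⟨z, h⟩
  have h1 := Set.ncard_sdiff_singleton_add_one he (Set.toFinite _)
  have h2 := Set.ncard_sdiff_singleton_add_one (s := G.edgeSet \ {s(a, b)}) (a := c) ⟨hcG, hne⟩
    (Set.toFinite _)
  have h3 := huni.2
  rw [Nat.card_coe_set_eq] at hcard h3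
  rw [Nat.card_eq_fintype_card, ← hcdef] at hcard
  omega

include hl huni hinj hadj in
lemma exists_isUnitPotential_of_isPath_deleteEdges {x y : V}
    (p : (G.deleteEdges (cycleEdges v)).Walk x y) (hp : p.IsPath) :
    ∃ g : V → ℝ, IsUnitPotential G x y g ∧ g x - g y = p.length ∧
      (∀ i j, g (v i) = g (v j)) ∧
      ∀ z w, (G.deleteEdges (cycleEdges v)).Reachable z w →
        ¬ (G.deleteEdges (cycleEdges v)).Reachable x z → g z = g w := by
  obtain ⟨g, hg, hlen, hconst⟩ := exists_isUnitPotential_of_isPath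
    (SimpleGraph.deleteEdges_le (cycleEdges v)) (fun a b hab => by
      rw [SimpleGraph.deleteEdges_adj] at hab
      exact isBridge_of_notMem_cycleEdges hl huni hinj hadj hab.1 hab.2) p hp
  refine ⟨g, hg, hlen, eq_of_cycleSucc_eq hl _ fun k => hconst _ _ (hadj k) fun hk => ?_, ?_⟩
  · have := p.edges_subset_edgeSet hk
    rw [SimpleGraph.mem_edgeSet, SimpleGraph.deleteEdges_adj] at this
    exact this.2 ⟨k, rfl⟩
  · rintro z w ⟨q⟩ hz
    induction q with
    | nil => rfl
    | cons h q ih =>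
      refine (hconst _ _ (SimpleGraph.deleteEdges_le _ h) fun hk => hz ?_).trans
        (ih fun hr => hz (hr.trans h.symm.reachable))
      exact ⟨p.takeUntil _ (p.fst_mem_support_of_mem_edges hk)⟩

include hl huni hinj hadj in
lemma eq_of_reachable_deleteEdges {i j : Fin l}
    (h : (G.deleteEdges (cycleEdges v)).Reachable (v i) (v j)) : i = j := by
  obtain ⟨p, hp⟩ := h.exists_isPath
  obtain ⟨g, -, hlen, hv, -⟩ := exists_isUnitPotential_of_isPath_deleteEdges hl huni hinj hadj p hp
  rw [hv i j, sub_self] at hlen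
  exact hinj (p.eq_of_length_eq_zero (by exact_mod_cast hlen.symm))

include hl huni in
lemma exists_reachable_deleteEdges (x : V) :
    ∃ i, (G.deleteEdges (cycleEdges v)).Reachable (v i) x := by
  obtain ⟨p⟩ := huni.1.preconnected x (v ⟨0, by omega⟩)
  generalize hz : v ⟨0, by omega⟩ = z at p
  induction p with
  | nil => subst hz; exact ⟨_, .refl _⟩
  | @cons x y _ h p ih =>
    by_cases hc : s(x, y) ∈ cycleEdges v
    · obtain ⟨k, hk⟩ := hc
      rcases Sym2.eq_iff.1 hk with ⟨rfl, -⟩ | ⟨-, rfl⟩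
      · exact ⟨_, .refl _⟩
      · exact ⟨_, .refl _⟩
    · obtain ⟨i, hi⟩ := ih hz
      refine ⟨i, hi.trans (SimpleGraph.Adj.reachable ?_)⟩
      exact (SimpleGraph.deleteEdges_adj.2 ⟨h, hc⟩).symm

include hl huni hinj hadj in
lemma mem_branch_iff {i : Fin l} {x : V} :
    x ∈ branch G (Set.range v) (v i) ↔
      (G.deleteEdges (cycleEdges v)).Reachable (v i) x := by
  constructor
  · rintro ⟨p, hp⟩
    have key : ∀ {a b : V} (q : G.Walk a b), (∀ y ∈ q.support, y ∉ Set.range v \ {v i}) →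
        (G.deleteEdges (cycleEdges v)).Reachable a b := by
      intro a b q hq
      induction q with
      | nil => exact .refl _
      | @cons a c b h q ih =>
        have hq1 := hq a (by simp)
        have hq2 := hq c (by simp)
        refine SimpleGraph.Reachable.trans (SimpleGraph.Adj.reachable ?_)
          (ih fun y hy => hq y (by simp [hy]))
        refine SimpleGraph.deleteEdges_adj.2 ⟨h, ?_⟩
        rintro ⟨k, hk⟩
        have hmem : ∀ m, v m ∉ Set.range v \ {v i} → m = i := by
          intro m hm
          by_contra hne
          exact hm ⟨⟨m, rfl⟩, fun h => hne (hinj h)⟩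
        rcases Sym2.eq_iff.1 hk with ⟨rfl, rfl⟩ | ⟨rfl, rfl⟩
        · exact cycleSucc_ne hl k ((hmem _ hq2).trans (hmem _ hq1).symm)
        · exact cycleSucc_ne hl k ((hmem _ hq1).trans (hmem _ hq2).symm)
    exact key p hp
  · rintro ⟨p⟩
    refine ⟨p.mapLe (SimpleGraph.deleteEdges_le _), ?_⟩
    rintro y hy ⟨⟨j, rfl⟩, hj⟩
    rw [SimpleGraph.Walk.support_mapLe_eq_support] at hy
    have := eq_of_reachable_deleteEdges hl huni hinj hadj ⟨p.takeUntil _ hy⟩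
    exact hj (by rw [this]; rfl)

include hl huni hinj hadj in
lemma deleteEdges_adj_of_induce_branch_adj {i : Fin l} {x y : branch G (Set.range v) (v i)}
    (h : (G.induce (branch G (Set.range v) (v i))).Adj x y) :
    (G.deleteEdges (cycleEdges v)).Adj x y := by
  refine SimpleGraph.deleteEdges_adj.2 ⟨h, ?_⟩
  rintro ⟨k, hk⟩
  have hx := (mem_branch_iff hl huni hinj hadj).1 x.2
  have hy := (mem_branch_iff hl huni hinj hadj).1 y.2
  have hroot : ∀ m, (G.deleteEdges (cycleEdges v)).Reachable (v i) (v m) → i = m :=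
    fun m => eq_of_reachable_deleteEdges hl huni hinj hadj
  rcases Sym2.eq_iff.1 hk with ⟨h1, h2⟩ | ⟨h1, h2⟩
  · exact cycleSucc_ne hl k ((hroot _ (h2 ▸ hy)).symm.trans (hroot _ (h1 ▸ hx)))
  · exact cycleSucc_ne hl k ((hroot _ (h2 ▸ hx)).symm.trans (hroot _ (h1 ▸ hy)))

include hl huni hinj hadj in
lemma connected_induce_branch (i : Fin l) :
    (G.induce (branch G (Set.range v) (v i))).Connected := by
  have key : ∀ {a b : V} (_ : (G.deleteEdges (cycleEdges v)).Walk a b)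
      (ha : a ∈ branch G (Set.range v) (v i)) (hb : b ∈ branch G (Set.range v) (v i)),
      (G.induce (branch G (Set.range v) (v i))).Reachable ⟨a, ha⟩ ⟨b, hb⟩ := by
    intro a b q ha hb
    induction q with
    | nil => exact .refl _
    | @cons a c b h q ih =>
      have hc : c ∈ branch G (Set.range v) (v i) := by
        rw [mem_branch_iff hl huni hinj hadj] at ha ⊢
        exact ha.trans h.reachable
      have hac : (G.induce (branch G (Set.range v) (v i))).Adj ⟨a, ha⟩ ⟨c, hc⟩ :=
        (SimpleGraph.deleteEdges_adj.1 h).1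
      exact hac.reachable.trans (ih hc hb)
  have hi : v i ∈ branch G (Set.range v) (v i) :=
    (mem_branch_iff hl huni hinj hadj).2 (.refl _)
  rw [SimpleGraph.connected_iff]
  refine ⟨fun x y => ?_, ⟨⟨v i, hi⟩⟩⟩
  obtain ⟨p⟩ := ((mem_branch_iff hl huni hinj hadj).1 x.2).symm.trans
    ((mem_branch_iff hl huni hinj hadj).1 y.2)
  exact key p x.2 y.2

include hl huni hinj hadj in
lemma exists_isPath_length_eq_dist_branch {i : Fin l} (x y : branch G (Set.range v) (v i)) :
    ∃ p : (G.deleteEdges (cycleEdges v)).Walk x y, p.IsPath ∧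
      p.length = (G.induce (branch G (Set.range v) (v i))).dist x y := by
  obtain ⟨p, hp, hlen⟩ :=
    (connected_induce_branch hl huni hinj hadj i).exists_path_of_dist x y
  let φ : G.induce (branch G (Set.range v) (v i)) →g G.deleteEdges (cycleEdges v) :=
    ⟨Subtype.val, fun h => deleteEdges_adj_of_induce_branch_adj hl huni hinj hadj h⟩
  exact ⟨p.map φ, hp.map Subtype.val_injective,
    (SimpleGraph.Walk.length_map _ _).trans hlen⟩

include hl huni hinj hadj in
lemma resistanceDistance_of_same_branch {i : Fin l} (x y : branch G (Set.range v) (v i)) :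
    resistanceDistance G (x : V) y = (G.induce (branch G (Set.range v) (v i))).dist x y := by
  obtain ⟨p, hp, hlen⟩ := exists_isPath_length_eq_dist_branch hl huni hinj hadj x y
  obtain ⟨g, hg, hg', -⟩ := exists_isUnitPotential_of_isPath_deleteEdges hl huni hinj hadj p hp
  rw [hg.resistanceDistance_eq, hg', hlen]

include hl huni hinj hadj in
lemma exists_isUnitPotential_cycle (i j : Fin l) :
    ∃ g : V → ℝ, IsUnitPotential G (v i) (v j) g ∧ g (v i) - g (v j) = cycleResistance i j ∧
      ∀ z w, (G.deleteEdges (cycleEdges v)).Reachable z w → g z = g w := by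
  choose π hπ using exists_reachable_deleteEdges (v := v) hl huni
  have hπr : ∀ z w, (G.deleteEdges (cycleEdges v)).Reachable z w → π z = π w :=
    fun z w h => eq_of_reachable_deleteEdges hl huni hinj hadj ((hπ z).trans (h.trans (hπ w).symm))
  have hπv : ∀ k, π (v k) = k :=
    fun k => eq_of_reachable_deleteEdges hl huni hinj hadj (hπ (v k))
  refine ⟨fun x => cyclePotential l i j (π x), fun f => ?_, ?_, fun z w h => by
    simp only [hπr z w h]⟩
  · unfold energyForm
    rw [sum_sum_eq_two_mul_sum v (fun k => v (cycleSucc k))]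
    · simp only [hadj, if_true, hπv]
      rw [sum_cyclePotential_mul hl i j (fun k => f (v k))]
      ring
    · intro x y
      simp only [G.adj_comm x y]
      split_ifs <;> ring
    · exact fun i j h => cycleEdge_injective hl hinj h
    · exact fun k => (hadj k).ne
    · intro x y h
      split_ifs with hxy
      · have : π x = π y := hπr x y (SimpleGraph.Adj.reachable
          (SimpleGraph.deleteEdges_adj.2 ⟨hxy, fun ⟨k, hk⟩ => h k hk.symm⟩))
        simp only [this, sub_self, zero_mul]
      · rfl
  · simp only [hπv, cycleResistance]

include hl huni hinj hadj in
lemma resistanceDistance_of_ne_branch {i j : Fin l} (hij : i ≠ j)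
    (hi : v i ∈ branch G (Set.range v) (v i)) (hj : v j ∈ branch G (Set.range v) (v j))
    (x : branch G (Set.range v) (v i)) (y : branch G (Set.range v) (v j)) :
    resistanceDistance G (x : V) y =
      (G.induce (branch G (Set.range v) (v i))).dist ⟨v i, hi⟩ x + cycleResistance i j +
        (G.induce (branch G (Set.range v) (v j))).dist ⟨v j, hj⟩ y := by
  obtain ⟨p, hp, hplen⟩ := exists_isPath_length_eq_dist_branch hl huni hinj hadj x ⟨v i, hi⟩
  obtain ⟨q, hq, hqlen⟩ := exists_isPath_length_eq_dist_branch hl huni hinj hadj ⟨v j, hj⟩ y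
  obtain ⟨g₁, hg₁, h₁, hv₁, hc₁⟩ :=
    exists_isUnitPotential_of_isPath_deleteEdges hl huni hinj hadj p hp
  obtain ⟨g₂, hg₂, h₂, hv₂, hc₂⟩ :=
    exists_isUnitPotential_of_isPath_deleteEdges hl huni hinj hadj q hq
  obtain ⟨g, hg, h, hc⟩ := exists_isUnitPotential_cycle hl huni hinj hadj i j
  have hx := (mem_branch_iff hl huni hinj hadj).1 x.2
  have hy := (mem_branch_iff hl huni hinj hadj).1 y.2
  rw [((hg₁.add hg).add hg₂).resistanceDistance_eq, SimpleGraph.dist_comm, ← hplen, ← hqlen,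
    ← h, ← h₁, ← h₂]
  have e1 := hc₁ _ _ hy
    fun hr => hij (eq_of_reachable_deleteEdges hl huni hinj hadj (hx.trans hr))
  have e2 := hc₂ _ _ hx
    fun hr => hij (eq_of_reachable_deleteEdges hl huni hinj hadj hr).symm
  have e3 := hc _ _ hx
  have e4 := hc _ _ hy
  have e5 := hv₁ i j
  have e6 := hv₂ i j
  simp only [Pi.add_apply]
  linarith

include hl huni hinj hadj in
/-- The Kirchhoff index of a unicyclic graph in terms of the orders, the distance sums and the root
distance sums of its branches. -/
lemma kirchhoffIndex_eq (hmem : ∀ i, v i ∈ branch G (Set.range v) (v i)) :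
    kirchhoffIndex G = (1 / 2) * ∑ i, ∑ j,
      if i = j then wienerIndex (G.induce (branch G (Set.range v) (v i))) * 2
      else Fintype.card (branch G (Set.range v) (v j)) *
          wienerAt (G.induce (branch G (Set.range v) (v i))) ⟨v i, hmem i⟩ +
        Fintype.card (branch G (Set.range v) (v i)) * Fintype.card (branch G (Set.range v) (v j)) *
          cycleResistance i j +
        Fintype.card (branch G (Set.range v) (v i)) *
          wienerAt (G.induce (branch G (Set.range v) (v j))) ⟨v j, hmem j⟩ := by
  have hbij : Function.Bijective
      (fun s : (Σ i, branch G (Set.range v) (v i)) => (s.2 : V)) := by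
    constructor
    · rintro ⟨i, x, hx⟩ ⟨j, y, hy⟩ (rfl : x = y)
      have : i = j := eq_of_reachable_deleteEdges hl huni hinj hadj
        (((mem_branch_iff hl huni hinj hadj).1 hx).trans
          ((mem_branch_iff hl huni hinj hadj).1 hy).symm)
      subst this
      rfl
    · intro x
      obtain ⟨i, hi⟩ := exists_reachable_deleteEdges (v := v) hl huni x
      exact ⟨⟨i, x, (mem_branch_iff hl huni hinj hadj).2 hi⟩, rfl⟩
  unfold kirchhoffIndex
  rw [← hbij.sum_comp, Fintype.sum_sigma]
  congr 1
  refine Finset.sum_congr rfl fun i _ => ?_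
  simp only [← hbij.sum_comp, Fintype.sum_sigma]
  rw [Finset.sum_comm]
  refine Finset.sum_congr rfl fun j _ => ?_
  split_ifs with hij
  · subst hij
    simp only [resistanceDistance_of_same_branch hl huni hinj hadj, wienerIndex]
    ring
  · simp only [resistanceDistance_of_ne_branch hl huni hinj hadj hij (hmem i) (hmem j), wienerAt,
      Finset.sum_add_distrib, Finset.sum_const, Finset.card_univ, nsmul_eq_mul, ← Finset.mul_sum]
    ring

end Cycle

/-- If `G = U(C_l; T_1,…,T_l)` has a branch `T_i` (`i < l`) that is not a path ending at
`v_i`, and `G' = U(C_l; P_1,…,P_{l−1}, T_l)` is obtained by replacing each `T_i` (`i < l`)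
by a path on `|V(T_i)|` vertices attached at its end-vertex `v'_i` while keeping the last
branch isomorphic to `T_l` (rooted at the cycle vertex), then `Kf(G) < Kf(G')`. -/
theorem statement3 {V V' : Type*} [Fintype V] [Fintype V']
    (G : SimpleGraph V) (G' : SimpleGraph V') (l : ℕ) (hl : 3 ≤ l)
    (huni : IsUnicyclic G) (huni' : IsUnicyclic G')
    (v : Fin l → V) (v' : Fin l → V')
    (hinj : Function.Injective v) (hinj' : Function.Injective v')
    (hadj : ∀ i : Fin l, G.Adj (v i) (v ⟨(i.val + 1) % l, Nat.mod_lt _ (by omega)⟩))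
    (hadj' : ∀ i : Fin l, G'.Adj (v' i) (v' ⟨(i.val + 1) % l, Nat.mod_lt _ (by omega)⟩))
    (hmem : ∀ i : Fin l, v i ∈ branch G (Set.range v) (v i))
    (hmem' : ∀ i : Fin l, v' i ∈ branch G' (Set.range v') (v' i))
    (last : Fin l) (hlast : last.val = l - 1)
    (hsize : ∀ i : Fin l, i ≠ last →
      Nat.card (branch G' (Set.range v') (v' i)) = Nat.card (branch G (Set.range v) (v i)))
    (hpaths : ∀ i : Fin l, i ≠ last →
      IsEndPath (G'.induce (branch G' (Set.range v') (v' i))) ⟨v' i, hmem' i⟩)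
    (hTl : ∃ e : G.induce (branch G (Set.range v) (v last)) ≃g
        G'.induce (branch G' (Set.range v') (v' last)),
      (e ⟨v last, hmem last⟩).val = v' last)
    (hnot : ∃ i : Fin l, i ≠ last ∧
      ¬ IsEndPath (G.induce (branch G (Set.range v) (v i))) ⟨v i, hmem i⟩) :
    kirchhoffIndex G < kirchhoffIndex G' := by
  have hadjS : ∀ i, G.Adj (v i) (v (cycleSucc i)) := hadj
  have hadjS' : ∀ i, G'.Adj (v' i) (v' (cycleSucc i)) := hadj'
  have hconn := connected_induce_branch hl huni hinj hadjS
  obtain ⟨e, he⟩ := hTl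
  have he' : e ⟨v last, hmem last⟩ = ⟨v' last, hmem' last⟩ := Subtype.ext he
  have hcard : ∀ i, Fintype.card (branch G' (Set.range v') (v' i)) =
      Fintype.card (branch G (Set.range v) (v i)) := by
    intro i
    by_cases hi : i = last
    · subst hi
      exact (Fintype.card_congr e.toEquiv).symm
    · simpa only [Nat.card_eq_fintype_card] using hsize i hi
  have hpos : ∀ i, (0 : ℝ) < Fintype.card (branch G (Set.range v) (v i)) := by
    intro i
    have : Nonempty (branch G (Set.range v) (v i)) := ⟨⟨v i, hmem i⟩⟩
    exact_mod_cast Fintype.card_pos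
  have hW : ∀ i, wienerIndex (G.induce (branch G (Set.range v) (v i))) ≤
      wienerIndex (G'.induce (branch G' (Set.range v') (v' i))) := by
    intro i
    by_cases hi : i = last
    · subst hi
      rw [wienerIndex_congr e]
    · exact wienerIndex_le_of_isEndPath (hconn i) (hpaths i hi) (hcard i)
  have hD : ∀ i, wienerAt (G.induce (branch G (Set.range v) (v i))) ⟨v i, hmem i⟩ ≤
      wienerAt (G'.induce (branch G' (Set.range v') (v' i))) ⟨v' i, hmem' i⟩ := by
    intro i
    by_cases hi : i = last
    · subst hi
      rw [← he', wienerAt_congr e]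
    · exact wienerAt_le_of_isEndPath (hconn i) (hpaths i hi) (hcard i) _
  obtain ⟨k, hk, hnk⟩ := hnot
  have hDk := wienerAt_lt_of_isEndPath (hconn k) hnk (hpaths k hk) (hcard k)
  rw [kirchhoffIndex_eq hl huni hinj hadjS hmem, kirchhoffIndex_eq hl huni' hinj' hadjS' hmem']
  simp only [hcard]
  have hterm : ∀ i j : Fin l,
      (if i = j then wienerIndex (G.induce (branch G (Set.range v) (v i))) * 2
        else Fintype.card (branch G (Set.range v) (v j)) *
            wienerAt (G.induce (branch G (Set.range v) (v i))) ⟨v i, hmem i⟩ +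
          Fintype.card (branch G (Set.range v) (v i)) *
            Fintype.card (branch G (Set.range v) (v j)) * cycleResistance i j +
          Fintype.card (branch G (Set.range v) (v i)) *
            wienerAt (G.induce (branch G (Set.range v) (v j))) ⟨v j, hmem j⟩) ≤
      (if i = j then wienerIndex (G'.induce (branch G' (Set.range v') (v' i))) * 2
        else Fintype.card (branch G (Set.range v) (v j)) *
            wienerAt (G'.induce (branch G' (Set.range v') (v' i))) ⟨v' i, hmem' i⟩ +
          Fintype.card (branch G (Set.range v) (v i)) *
            Fintype.card (branch G (Set.range v) (v j)) * cycleResistance i j +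
          Fintype.card (branch G (Set.range v) (v i)) *
            wienerAt (G'.induce (branch G' (Set.range v') (v' j))) ⟨v' j, hmem' j⟩) := by
    intro i j
    split_ifs
    · linarith [hW i]
    · gcongr
      · exact hD i
      · exact hD j
  refine mul_lt_mul_of_pos_left ?_ (by norm_num)
  refine Finset.sum_lt_sum (fun i _ => Finset.sum_le_sum fun j _ => hterm i j)
    ⟨k, Finset.mem_univ k, ?_⟩
  refine Finset.sum_lt_sum (fun j _ => hterm k j) ⟨last, Finset.mem_univ last, ?_⟩
  rw [if_neg hk, if_neg hk]
  have h1 := mul_lt_mul_of_pos_left hDk (hpos last)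
  have h2 := mul_le_mul_of_nonneg_left (hD last) (hpos k).le
  linarith

end KfPaper
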